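/- arXiv:2107.05770 — 4 statements merged into one kernel-verified Lean document; each statement's English description precedes it below -/
import Mathlib

section
/- Let Ω = [B₋, B₊] with B₋ < B₊, let a, b : ℝ → ℝ be continuously differentiable with b(x) > 0 on Ω, and let u : ℝ × [0,∞) → ℝ be twice continuously differentiable and solve the shifted wave equation ∂t(∂t u − a ∂x u) − ∂x(a(∂t u − a ∂x u) + b ∂x u) = 0 for all x ∈ Ω and t ≥ 0. Define the energy E_b(t) := ∫_Ω (∂t u − a ∂x u)² dx + ∫_Ω b (∂x u)² dx, the constant C_{a,b} := max_{x∈Ω} (|a'(x)| + |a'(x) − (a(x)/b(x)) b'(x)|), the flux F(u) := a(∂t u − a ∂x u) + b ∂x u, and the boundary term BT_s(t) := [(∂t u − a ∂x u) F(u) + b (∂x u)(∂t u)](B₊, t) − [(∂t u − a ∂x u) F(u) + b (∂x u)(∂t u)](B₋, t). Then E_b is differentiable and for all t ≥ 0, d/dt E_b(t) ≤ C_{a,b} · E_b(t) + BT_s(t). -/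
open MeasureTheory

/-- Partial derivative in time of `u : ℝ → ℝ → ℝ` (first argument is space). -/
noncomputable def pdt (u : ℝ → ℝ → ℝ) (x t : ℝ) : ℝ := deriv (fun s => u x s) t

/-- Partial derivative in space of `u : ℝ → ℝ → ℝ` (first argument is space). -/
noncomputable def pdx (u : ℝ → ℝ → ℝ) (x t : ℝ) : ℝ := deriv (fun y => u y t) x

/-- Time derivative of a slice of a differentiable function on the plane. -/
lemma DifferentiableAt.hasDerivAt_slice_snd {f : ℝ × ℝ → ℝ} {x t : ℝ}
    (hf : DifferentiableAt ℝ f (x, t)) :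
    HasDerivAt (fun s => f (x, s)) (fderiv ℝ f (x, t) (0, 1)) t :=
  hf.hasFDerivAt.comp_hasDerivAt t ((hasDerivAt_const t x).prodMk (hasDerivAt_id t))

/-- Space derivative of a slice of a differentiable function on the plane. -/
lemma DifferentiableAt.hasDerivAt_slice_fst {f : ℝ × ℝ → ℝ} {x t : ℝ}
    (hf : DifferentiableAt ℝ f (x, t)) :
    HasDerivAt (fun y => f (y, t)) (fderiv ℝ f (x, t) (1, 0)) x :=
  hf.hasFDerivAt.comp_hasDerivAt x ((hasDerivAt_id x).prodMk (hasDerivAt_const x t))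

/-- Differentiation under the integral sign for a `C¹` integrand on a bounded interval. -/
lemma ContDiff.hasDerivAt_intervalIntegral_slice {f : ℝ × ℝ → ℝ} (hf : ContDiff ℝ 1 f)
    (l r t : ℝ) :
    HasDerivAt (fun s => ∫ x in l..r, f (x, s))
      (∫ x in l..r, fderiv ℝ f (x, t) (0, 1)) t := by
  have hcont : Continuous fun p : ℝ × ℝ => fderiv ℝ f p (0, 1) :=
    (hf.continuous_fderiv one_ne_zero).clm_apply continuous_const
  obtain ⟨M, hM⟩ := (isCompact_uIcc.prod (isCompact_closedBall t 1)).exists_bound_of_continuousOn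
    (s := Set.uIcc l r ×ˢ Metric.closedBall t 1) hcont.continuousOn
  have hslice : ∀ s, Continuous fun x => f (x, s) := fun s =>
    hf.continuous.comp (continuous_id.prodMk continuous_const)
  refine (intervalIntegral.hasDerivAt_integral_of_dominated_loc_of_deriv_le
    (F := fun s x => f (x, s)) (F' := fun s x => fderiv ℝ f (x, s) (0, 1))
    (bound := fun _ => M) (Metric.closedBall_mem_nhds t one_pos)
    (Filter.Eventually.of_forall fun s => (hslice s).aestronglyMeasurable)
    ((hslice t).intervalIntegrable l r)
    (hcont.comp (continuous_id.prodMk continuous_const)).aestronglyMeasurable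
    (Filter.Eventually.of_forall fun x hx s hs => hM (x, s) ⟨Set.uIoc_subset_uIcc hx, hs⟩)
    intervalIntegrable_const
    (Filter.Eventually.of_forall fun x _ s _ =>
      (hf.differentiable one_ne_zero (x, s)).hasDerivAt_slice_snd)).2

/-- continuous energy estimate `d/dt E_b ≤ C_{a,b} E_b + BT_s` for the
shifted wave equation with variable coefficients. -/
theorem energy_estimate_continuous
    (Bm Bp : ℝ) (hB : Bm < Bp)
    (a b : ℝ → ℝ) (ha : ContDiff ℝ 1 a) (hb : ContDiff ℝ 1 b)
    (hbpos : ∀ x ∈ Set.Icc Bm Bp, 0 < b x)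
    (u : ℝ → ℝ → ℝ) (hu : ContDiff ℝ 2 (fun p : ℝ × ℝ => u p.1 p.2))
    (hpde : ∀ x ∈ Set.Icc Bm Bp, ∀ t : ℝ, 0 ≤ t →
      deriv (fun s => pdt u x s - a x * pdx u x s) t
        - deriv (fun y => a y * (pdt u y t - a y * pdx u y t) + b y * pdx u y t) x = 0)
    (E : ℝ → ℝ)
    (hE : E = fun t => (∫ x in Bm..Bp, (pdt u x t - a x * pdx u x t) ^ 2)
        + ∫ x in Bm..Bp, b x * (pdx u x t) ^ 2)
    (C : ℝ)
    (hC : C = sSup ((fun x => |deriv a x| + |deriv a x - a x / b x * deriv b x|) ''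
        Set.Icc Bm Bp))
    (BT : ℝ → ℝ)
    (hBT : BT = fun t =>
      ((pdt u Bp t - a Bp * pdx u Bp t)
          * (a Bp * (pdt u Bp t - a Bp * pdx u Bp t) + b Bp * pdx u Bp t)
        + b Bp * pdx u Bp t * pdt u Bp t)
      - ((pdt u Bm t - a Bm * pdx u Bm t)
          * (a Bm * (pdt u Bm t - a Bm * pdx u Bm t) + b Bm * pdx u Bm t)
        + b Bm * pdx u Bm t * pdt u Bm t)) :
    ∀ t : ℝ, 0 ≤ t → DifferentiableAt ℝ E t ∧ deriv E t ≤ C * E t + BT t := by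
  intro t ht
  set U : ℝ × ℝ → ℝ := fun p => u p.1 p.2 with hU
  have hUd : Differentiable ℝ U := hu.differentiable two_ne_zero
  set V : ℝ × ℝ → ℝ := fun p => fderiv ℝ U p (0, 1) with hV
  set P : ℝ × ℝ → ℝ := fun p => fderiv ℝ U p (1, 0) with hP
  have hpdt : ∀ x s, pdt u x s = V (x, s) := fun x s => (hUd (x, s)).hasDerivAt_slice_snd.deriv
  have hpdx : ∀ x s, pdx u x s = P (x, s) := fun x s => (hUd (x, s)).hasDerivAt_slice_fst.deriv
  have hDC : ContDiff ℝ 1 (fderiv ℝ U) := hu.fderiv_right (by norm_num)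
  have hVC : ContDiff ℝ 1 V := hDC.clm_apply contDiff_const
  have hPC : ContDiff ℝ 1 P := hDC.clm_apply contDiff_const
  have hsymm : ∀ p, fderiv ℝ P p (0, 1) = fderiv ℝ V p (1, 0) := by
    intro p
    have hD : DifferentiableAt ℝ (fderiv ℝ U) p := hDC.differentiable one_ne_zero p
    have h1 := (hD.hasFDerivAt.clm_apply (hasFDerivAt_const ((1, 0) : ℝ × ℝ) p)).fderiv
    have h2 := (hD.hasFDerivAt.clm_apply (hasFDerivAt_const ((0, 1) : ℝ × ℝ) p)).fderiv
    rw [hP, hV, h1, h2]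
    simpa using (hu.contDiffAt.isSymmSndFDerivAt (x := p) (by simp)) (0, 1) (1, 0)
  simp only [hpdt, hpdx] at hpde hE hBT
  have haC : ContDiff ℝ 1 fun p : ℝ × ℝ => a p.1 := ha.comp contDiff_fst
  have hbC : ContDiff ℝ 1 fun p : ℝ × ℝ => b p.1 := hb.comp contDiff_fst
  set e : ℝ × ℝ → ℝ := fun p => (V p - a p.1 * P p) ^ 2 + b p.1 * P p ^ 2 with he
  have heC : ContDiff ℝ 1 e := ((hVC.sub (haC.mul hPC)).pow 2).add (hbC.mul (hPC.pow 2))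
  set G : ℝ → ℝ := fun x =>
    (V (x, t) - a x * P (x, t)) * (a x * (V (x, t) - a x * P (x, t)) + b x * P (x, t))
      + b x * P (x, t) * V (x, t) with hG
  have hpt : ContDiff ℝ 1 fun x : ℝ => (x, t) := contDiff_id.prodMk contDiff_const
  have hVt : ContDiff ℝ 1 fun x => V (x, t) := hVC.comp hpt
  have hPt : ContDiff ℝ 1 fun x => P (x, t) := hPC.comp hpt
  have hGC : ContDiff ℝ 1 G := by
    have hW := hVt.sub (ha.mul hPt)
    exact (hW.mul ((ha.mul hW).add (hb.mul hPt))).add ((hb.mul hPt).mul hVt)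
  have hG'c : Continuous (deriv G) := hGC.continuous_deriv le_rfl
  have hFTC : ∫ x in Bm..Bp, deriv G x = BT t := by
    rw [intervalIntegral.integral_deriv_eq_sub
      (fun x _ => hGC.differentiable one_ne_zero x) (hG'c.intervalIntegrable _ _), hBT]
  have hEe : E = fun s => ∫ x in Bm..Bp, e (x, s) := by
    rw [hE]
    funext s
    have hps : Continuous fun x : ℝ => (x, s) := continuous_id.prodMk continuous_const
    have hVs : Continuous fun x => V (x, s) := hVC.continuous.comp hps
    have hPs : Continuous fun x => P (x, s) := hPC.continuous.comp hps
    exact (intervalIntegral.integral_add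
      (((hVs.sub (ha.continuous.mul hPs)).pow 2).intervalIntegrable _ _)
      ((hb.continuous.mul (hPs.pow 2)).intervalIntegrable _ _)).symm
  have hEd : HasDerivAt E (∫ x in Bm..Bp, fderiv ℝ e (x, t) (0, 1)) t := by
    rw [hEe]
    exact heC.hasDerivAt_intervalIntegral_slice Bm Bp t
  refine ⟨hEd.differentiableAt, ?_⟩
  have hcoef : ∀ x ∈ Set.Icc Bm Bp,
      |deriv a x| + |deriv a x - a x / b x * deriv b x| ≤ C := by
    intro x hx
    have ha' := (ha.continuous_deriv le_rfl).continuousOn (s := Set.Icc Bm Bp)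
    have hb' := (hb.continuous_deriv le_rfl).continuousOn (s := Set.Icc Bm Bp)
    have hc : ContinuousOn (fun x => |deriv a x| + |deriv a x - a x / b x * deriv b x|)
        (Set.Icc Bm Bp) :=
      ha'.abs.add (ha'.sub ((ha.continuous.continuousOn.div hb.continuous.continuousOn
        fun x hx => (hbpos x hx).ne').mul hb')).abs
    rw [hC]
    exact le_csSup (isCompact_Icc.image_of_continuousOn hc).bddAbove ⟨x, hx, rfl⟩
  have hpoint : ∀ x ∈ Set.Icc Bm Bp,
      fderiv ℝ e (x, t) (0, 1) ≤ C * e (x, t) + deriv G x := by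
    intro x hx
    have dVt := (hVC.differentiable one_ne_zero (x, t)).hasDerivAt_slice_snd
    have dPt := (hPC.differentiable one_ne_zero (x, t)).hasDerivAt_slice_snd
    have dVx := (hVC.differentiable one_ne_zero (x, t)).hasDerivAt_slice_fst
    have dPx := (hPC.differentiable one_ne_zero (x, t)).hasDerivAt_slice_fst
    have da := (ha.differentiable one_ne_zero x).hasDerivAt
    have db := (hb.differentiable one_ne_zero x).hasDerivAt
    rw [hsymm] at dPt
    have dWt := dVt.sub (dPt.const_mul (a x))
    have dWx := dVx.sub (da.mul dPx)
    have dFx := (da.mul dWx).add (db.mul dPx)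
    have het := (heC.differentiable one_ne_zero (x, t)).hasDerivAt_slice_snd.unique
      ((dWt.pow 2).add ((dPt.pow 2).const_mul (b x)))
    have hGx : deriv G x = _ := ((dWx.mul dFx).add ((db.mul dPx).mul dVx)).deriv
    have hp : _ - _ = (0 : ℝ) := (congrArg₂ (· - ·) dWt.deriv dFx.deriv).symm.trans (hpde x hx t ht)
    have hbx := hbpos x hx
    have hCx := hcoef x hx
    rw [het, hGx]
    simp only [he, Pi.sub_apply, Pi.mul_apply, Pi.add_apply] at hp ⊢
    set v := V (x, t)
    set p := P (x, t)
    set vt := fderiv ℝ V (x, t) (0, 1)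
    set vx := fderiv ℝ V (x, t) (1, 0)
    set px := fderiv ℝ P (x, t) (1, 0)
    set a' := deriv a x
    set b' := deriv b x
    have h1 : a' * (v - a x * p) ^ 2 ≤ C * (v - a x * p) ^ 2 :=
      mul_le_mul_of_nonneg_right
        ((le_abs_self _).trans ((le_add_of_nonneg_right (abs_nonneg _)).trans hCx)) (sq_nonneg _)
    have h2 : (a' - a x / b x * b') * (b x * p ^ 2) ≤ C * (b x * p ^ 2) :=
      mul_le_mul_of_nonneg_right
        ((le_abs_self _).trans ((le_add_of_nonneg_left (abs_nonneg _)).trans hCx))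
        (by positivity)
    have h3 : (a' - a x / b x * b') * (b x * p ^ 2) = a' * b x * p ^ 2 - a x * b' * p ^ 2 := by
      field_simp
    rw [h3] at h2
    rw [sub_eq_zero] at hp
    rw [hp]
    push_cast
    linarith
  have hpc : Continuous fun x : ℝ => (x, t) := hpt.continuous
  have hec : Continuous fun x => C * e (x, t) := continuous_const.mul (heC.continuous.comp hpc)
  have het : Continuous fun x => fderiv ℝ e (x, t) (0, 1) :=
    ((heC.continuous_fderiv one_ne_zero).comp hpc).clm_apply continuous_const
  calc deriv E t = ∫ x in Bm..Bp, fderiv ℝ e (x, t) (0, 1) := hEd.deriv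
    _ ≤ ∫ x in Bm..Bp, (C * e (x, t) + deriv G x) :=
      intervalIntegral.integral_mono_on hB.le (het.intervalIntegrable _ _)
        ((hec.add hG'c).intervalIntegrable _ _) hpoint
    _ = C * E t + BT t := by
      rw [intervalIntegral.integral_add (hec.intervalIntegrable _ _)
        (hG'c.intervalIntegrable _ _), intervalIntegral.integral_const_mul, hFTC, hEe]
end

section
/- Let Ω = [B₋, B₊] be split at an interior point x_I ∈ (B₋, B₊) into Ω₋ = [B₋, x_I] and Ω₊ = [x_I, B₊]. Let a, b : ℝ → ℝ be continuously differentiable with b > 0 on Ω, and let u⁻ on Ω₋ × [0,∞) and u⁺ on Ω₊ × [0,∞) be twice continuously differentiable solutions of the shifted wave equation ∂t(∂t u − a ∂x u) − ∂x(a(∂t u − a ∂x u) + b ∂x u) = 0 on their respective subdomains. Assume the interface conditions at x = x_I: (∂t u⁻ − a ∂x u⁻)(x_I, t) = (∂t u⁺ − a ∂x u⁺)(x_I, t) and F(u⁻)(x_I, t) = F(u⁺)(x_I, t) for all t ≥ 0, where F(u) = a(∂t u − a ∂x u) + b ∂x u. Assume also that the external boundary contributions vanish: [(∂t u⁻ −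 a ∂x u⁻) F(u⁻) + b (∂x u⁻)(∂t u⁻)](B₋, t) = 0 and [(∂t u⁺ − a ∂x u⁺) F(u⁺) + b (∂x u⁺)(∂t u⁺)](B₊, t) = 0 for all t ≥ 0. Let E_b(t) := E_b⁻(t) + E_b⁺(t), where E_b^±(t) = ∫_{Ω_±} (∂t u^± − a ∂x u^±)² dx + ∫_{Ω_±} b (∂x u^±)² dx, and let C_{a,b} := max_{x∈Ω}(|a'(x)| + |a'(x) − (a(x)/b(x)) b'(x)|). Then d/dt E_b(t) ≤ C_{a,b} E_b(t) for all t ≥ 0; in particular, if a and b are constants then C_{a,b} = 0 and d/dt E_b(t) = 0. -/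
open MeasureTheory

/-- The derivative of a slice in the first variable is the total derivative along the first axis. -/
theorem hasDerivAt_slice_fst {g : ℝ → ℝ → ℝ} (hg : ContDiff ℝ 1 (fun p : ℝ × ℝ => g p.1 p.2))
    (x t : ℝ) :
    HasDerivAt (fun y => g y t) (fderiv ℝ (fun p : ℝ × ℝ => g p.1 p.2) (x, t) (1, 0)) x := by
  have h := (hg.differentiable one_ne_zero (x, t)).hasFDerivAt
  exact h.comp_hasDerivAt x ((hasDerivAt_id x).prodMk (hasDerivAt_const x t))

/-- The derivative of a slice in the second variable is the total derivative along the second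
axis. -/
theorem hasDerivAt_slice_snd {g : ℝ → ℝ → ℝ} (hg : ContDiff ℝ 1 (fun p : ℝ × ℝ => g p.1 p.2))
    (x t : ℝ) :
    HasDerivAt (fun s => g x s) (fderiv ℝ (fun p : ℝ × ℝ => g p.1 p.2) (x, t) (0, 1)) t := by
  have h := (hg.differentiable one_ne_zero (x, t)).hasFDerivAt
  exact h.comp_hasDerivAt t ((hasDerivAt_const t x).prodMk (hasDerivAt_id t))

theorem pdx_eq_fderiv {g : ℝ → ℝ → ℝ} (hg : ContDiff ℝ 1 (fun p : ℝ × ℝ => g p.1 p.2)) :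
    (fun p : ℝ × ℝ => pdx g p.1 p.2) =
      fun p => fderiv ℝ (fun p : ℝ × ℝ => g p.1 p.2) p (1, 0) :=
  funext fun p => (hasDerivAt_slice_fst hg p.1 p.2).deriv

theorem pdt_eq_fderiv {g : ℝ → ℝ → ℝ} (hg : ContDiff ℝ 1 (fun p : ℝ × ℝ => g p.1 p.2)) :
    (fun p : ℝ × ℝ => pdt g p.1 p.2) =
      fun p => fderiv ℝ (fun p : ℝ × ℝ => g p.1 p.2) p (0, 1) :=
  funext fun p => (hasDerivAt_slice_snd hg p.1 p.2).deriv

theorem continuous_pdt {g : ℝ → ℝ → ℝ} (hg : ContDiff ℝ 1 (fun p : ℝ × ℝ => g p.1 p.2)) :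
    Continuous (fun p : ℝ × ℝ => pdt g p.1 p.2) := by
  rw [pdt_eq_fderiv hg]
  exact (hg.continuous_fderiv one_ne_zero).clm_apply continuous_const

theorem contDiff_pdt {u : ℝ → ℝ → ℝ} (hu : ContDiff ℝ 2 (fun p : ℝ × ℝ => u p.1 p.2)) :
    ContDiff ℝ 1 (fun p : ℝ × ℝ => pdt u p.1 p.2) := by
  rw [pdt_eq_fderiv (hu.of_le one_le_two)]
  exact (hu.fderiv_right (by norm_num)).clm_apply contDiff_const

theorem contDiff_pdx {u : ℝ → ℝ → ℝ} (hu : ContDiff ℝ 2 (fun p : ℝ × ℝ => u p.1 p.2)) :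
    ContDiff ℝ 1 (fun p : ℝ × ℝ => pdx u p.1 p.2) := by
  rw [pdx_eq_fderiv (hu.of_le one_le_two)]
  exact (hu.fderiv_right (by norm_num)).clm_apply contDiff_const

/-- Equality of mixed partial derivatives. -/
theorem pdt_pdx_comm {u : ℝ → ℝ → ℝ} (hu : ContDiff ℝ 2 (fun p : ℝ × ℝ => u p.1 p.2))
    (x t : ℝ) : pdt (pdx u) x t = pdx (pdt u) x t := by
  have hsymm : IsSymmSndFDerivAt ℝ (fun p : ℝ × ℝ => u p.1 p.2) (x, t) :=
    hu.contDiffAt.isSymmSndFDerivAt (by simp)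
  have hd : DifferentiableAt ℝ (fderiv ℝ (fun p : ℝ × ℝ => u p.1 p.2)) (x, t) :=
    (hu.fderiv_right (m := 1) (by norm_num)).differentiable one_ne_zero _
  have h1 : pdt (pdx u) x t = _ := (hasDerivAt_slice_snd (contDiff_pdx hu) x t).deriv
  have h2 : pdx (pdt u) x t = _ := (hasDerivAt_slice_fst (contDiff_pdt hu) x t).deriv
  rw [h1, h2, pdx_eq_fderiv (hu.of_le one_le_two), pdt_eq_fderiv (hu.of_le one_le_two),
    fderiv_clm_apply hd (differentiableAt_const _), fderiv_clm_apply hd (differentiableAt_const _)]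
  simpa using hsymm (0, 1) (1, 0)

/-- Differentiation under the integral sign for a continuously differentiable integrand. -/
theorem hasDerivAt_intervalIntegral_pdt {g : ℝ → ℝ → ℝ}
    (hg : ContDiff ℝ 1 (fun p : ℝ × ℝ => g p.1 p.2)) (l r t : ℝ) :
    HasDerivAt (fun s => ∫ x in l..r, g x s) (∫ x in l..r, pdt g x t) t := by
  have hc := continuous_pdt hg
  have hslice : ∀ s, Continuous fun x => g x s := fun s =>
    hg.continuous.comp (continuous_id.prodMk continuous_const)
  have hslice' : Continuous fun x => pdt g x t :=
    hc.comp (continuous_id.prodMk continuous_const)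
  obtain ⟨M, hM⟩ := (isCompact_uIcc.prod (isCompact_closedBall t 1)).exists_bound_of_continuousOn
    (s := Set.uIcc l r ×ˢ Metric.closedBall t 1) hc.continuousOn
  refine (intervalIntegral.hasDerivAt_integral_of_dominated_loc_of_deriv_le
    (F := fun s x => g x s) (F' := fun s x => pdt g x s) (bound := fun _ => M)
    (Metric.closedBall_mem_nhds t one_pos) (.of_forall fun s => (hslice s).aestronglyMeasurable)
    ((hslice t).intervalIntegrable l r) hslice'.aestronglyMeasurable
    (.of_forall fun x hx s hs => hM (x, s) ⟨Set.uIoc_subset_uIcc hx, hs⟩)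
    intervalIntegrable_const
    (.of_forall fun x _ s _ => ?_)).2
  exact (hasDerivAt_slice_snd hg x s).differentiableAt.hasDerivAt

/-- The energy identity on a single subdomain: the time derivative of the energy is the difference
of the boundary terms plus a zeroth-order bulk term. -/
theorem hasDerivAt_energy {a b : ℝ → ℝ} (ha : ContDiff ℝ 1 a) (hb : ContDiff ℝ 1 b)
    {u : ℝ → ℝ → ℝ} (hu : ContDiff ℝ 2 (fun p : ℝ × ℝ => u p.1 p.2)) {l r : ℝ} (hlr : l ≤ r)
    {t : ℝ}
    (hpde : ∀ x ∈ Set.Icc l r,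
      deriv (fun s => pdt u x s - a x * pdx u x s) t
        - deriv (fun y => a y * (pdt u y t - a y * pdx u y t) + b y * pdx u y t) x = 0) :
    HasDerivAt (fun t => (∫ x in l..r, (pdt u x t - a x * pdx u x t) ^ 2)
        + ∫ x in l..r, b x * (pdx u x t) ^ 2)
      (((pdt u r t - a r * pdx u r t)
          * (a r * (pdt u r t - a r * pdx u r t) + b r * pdx u r t)
          + b r * pdx u r t * pdt u r t)
        - ((pdt u l t - a l * pdx u l t)
          * (a l * (pdt u l t - a l * pdx u l t) + b l * pdx u l t)
          + b l * pdx u l t * pdt u l t)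
        + ∫ x in l..r, (deriv a x * (pdt u x t - a x * pdx u x t) ^ 2
            + (deriv a x * b x - a x * deriv b x) * (pdx u x t) ^ 2)) t := by
  have hP := contDiff_pdt hu
  have hW := contDiff_pdx hu
  have haf : ContDiff ℝ 1 fun p : ℝ × ℝ => a p.1 := ha.comp contDiff_fst
  have hbf : ContDiff ℝ 1 fun p : ℝ × ℝ => b p.1 := hb.comp contDiff_fst
  have hg1 : ContDiff ℝ 1 fun p : ℝ × ℝ => (pdt u p.1 p.2 - a p.1 * pdx u p.1 p.2) ^ 2 :=
    (hP.sub (haf.mul hW)).pow 2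
  have hg2 : ContDiff ℝ 1 fun p : ℝ × ℝ => b p.1 * (pdx u p.1 p.2) ^ 2 := hbf.mul (hW.pow 2)
  have hslice : ∀ {g : ℝ → ℝ → ℝ}, Continuous (fun p : ℝ × ℝ => g p.1 p.2) →
      Continuous fun x => g x t := fun h => h.comp (continuous_id.prodMk continuous_const)
  have hd := (hasDerivAt_intervalIntegral_pdt (g := fun x t => (pdt u x t - a x * pdx u x t) ^ 2)
    hg1 l r t).add
    (hasDerivAt_intervalIntegral_pdt (g := fun x t => b x * (pdx u x t) ^ 2) hg2 l r t)
  have hac := ha.continuous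
  have hbc := hb.continuous
  have ha'c := ha.continuous_deriv le_rfl
  have hb'c := hb.continuous_deriv le_rfl
  have hPc := hslice hP.continuous
  have hWc := hslice hW.continuous
  have hRc : Continuous fun x => deriv a x * (pdt u x t - a x * pdx u x t) ^ 2
      + (deriv a x * b x - a x * deriv b x) * (pdx u x t) ^ 2 := by fun_prop
  have hc1 := hslice (g := pdt fun x t => (pdt u x t - a x * pdx u x t) ^ 2) (continuous_pdt hg1)
  have hc2 := hslice (g := pdt fun x t => b x * (pdx u x t) ^ 2) (continuous_pdt hg2)
  have hc12 : Continuous fun x => pdt (fun x t => (pdt u x t - a x * pdx u x t) ^ 2) x t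
      + pdt (fun x t => b x * (pdx u x t) ^ 2) x t := hc1.add hc2
  refine hd.congr_deriv ?_
  rw [← intervalIntegral.integral_add (hc1.intervalIntegrable _ _) (hc2.intervalIntegrable _ _),
    ← sub_eq_iff_eq_add,
    ← intervalIntegral.integral_sub (hc12.intervalIntegrable _ _)
      (hRc.intervalIntegrable _ _)]
  refine intervalIntegral.integral_eq_sub_of_hasDerivAt
    (f := fun x => (pdt u x t - a x * pdx u x t)
          * (a x * (pdt u x t - a x * pdx u x t) + b x * pdx u x t)
          + b x * pdx u x t * pdt u x t) (fun x hx => ?_)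
    ((hc12.sub hRc).intervalIntegrable _ _)
  rw [Set.uIcc_of_le hlr] at hx
  have dA : HasDerivAt a (deriv a x) x := (ha.differentiable one_ne_zero x).hasDerivAt
  have dB : HasDerivAt b (deriv b x) x := (hb.differentiable one_ne_zero x).hasDerivAt
  have dPx : HasDerivAt (fun y => pdt u y t) (pdx (pdt u) x t) x :=
    (hasDerivAt_slice_fst hP x t).differentiableAt.hasDerivAt
  have dWx : HasDerivAt (fun y => pdx u y t) (pdx (pdx u) x t) x :=
    (hasDerivAt_slice_fst hW x t).differentiableAt.hasDerivAt
  have dPt : HasDerivAt (fun s => pdt u x s) (pdt (pdt u) x t) t :=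
    (hasDerivAt_slice_snd hP x t).differentiableAt.hasDerivAt
  have dWt : HasDerivAt (fun s => pdx u x s) (pdx (pdt u) x t) t := by
    rw [← pdt_pdx_comm hu]
    exact (hasDerivAt_slice_snd hW x t).differentiableAt.hasDerivAt
  have dVt := dPt.sub (dWt.const_mul (a x))
  have dVx := dPx.sub (dA.mul dWx)
  have dFx := (dA.mul dVx).add (dB.mul dWx)
  have e1 : pdt (fun x t => (pdt u x t - a x * pdx u x t) ^ 2) x t = _ := (dVt.pow 2).deriv
  have e2 : pdt (fun x t => b x * (pdx u x t) ^ 2) x t = _ :=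
    ((dWt.pow 2).const_mul (b x)).deriv
  have ePt := hpde x hx
  have f1 : deriv (fun s => pdt u x s - a x * pdx u x s) t = _ := dVt.deriv
  have f2 : deriv (fun y => a y * (pdt u y t - a y * pdx u y t) + b y * pdx u y t) x = _ :=
    dFx.deriv
  rw [f1, f2] at ePt
  refine ((dVx.mul dFx).add ((dB.mul dWx).mul dPx)).congr_deriv ?_
  rw [e1, e2]
  simp only [Pi.mul_apply, Pi.sub_apply, Pi.add_apply] at ePt ⊢
  push_cast
  linear_combination (-2 * (pdt u x t - a x * pdx u x t)) * ePt

/-- The bulk term of the energy identity is controlled by the energy. -/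
theorem integral_bulk_le {a b : ℝ → ℝ} (ha : ContDiff ℝ 1 a) (hb : ContDiff ℝ 1 b)
    {u : ℝ → ℝ → ℝ} (hu : ContDiff ℝ 2 (fun p : ℝ × ℝ => u p.1 p.2)) {l r : ℝ} (hlr : l ≤ r)
    (hpos : ∀ x ∈ Set.Icc l r, 0 < b x) {C : ℝ}
    (hC : ∀ x ∈ Set.Icc l r, |deriv a x| + |deriv a x - a x / b x * deriv b x| ≤ C) (t : ℝ) :
    ∫ x in l..r, (deriv a x * (pdt u x t - a x * pdx u x t) ^ 2
        + (deriv a x * b x - a x * deriv b x) * (pdx u x t) ^ 2) ≤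
      C * ((∫ x in l..r, (pdt u x t - a x * pdx u x t) ^ 2)
        + ∫ x in l..r, b x * (pdx u x t) ^ 2) := by
  have hac := ha.continuous
  have hbc := hb.continuous
  have ha'c := ha.continuous_deriv le_rfl
  have hb'c := hb.continuous_deriv le_rfl
  have hPc : Continuous fun x => pdt u x t :=
    (contDiff_pdt hu).continuous.comp (continuous_id.prodMk continuous_const)
  have hWc : Continuous fun x => pdx u x t :=
    (contDiff_pdx hu).continuous.comp (continuous_id.prodMk continuous_const)
  have hc1 : Continuous fun x => (pdt u x t - a x * pdx u x t) ^ 2 := by fun_prop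
  have hc2 : Continuous fun x => b x * (pdx u x t) ^ 2 := by fun_prop
  rw [← intervalIntegral.integral_add (hc1.intervalIntegrable _ _) (hc2.intervalIntegrable _ _),
    ← intervalIntegral.integral_const_mul]
  refine intervalIntegral.integral_mono_on hlr (Continuous.intervalIntegrable (by fun_prop) _ _)
    (Continuous.intervalIntegrable (by fun_prop) _ _) fun x hx => ?_
  have hbx := hpos x hx
  have hCx := hC x hx
  have h1 : deriv a x ≤ C :=
    (le_abs_self _).trans ((le_add_of_nonneg_right (abs_nonneg _)).trans hCx)
  have h2 : deriv a x - a x / b x * deriv b x ≤ C :=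
    (le_abs_self _).trans ((le_add_of_nonneg_left (abs_nonneg _)).trans hCx)
  have h3 : deriv a x * b x - a x * deriv b x =
      (deriv a x - a x / b x * deriv b x) * b x := by field_simp
  rw [h3, mul_add, mul_assoc]
  gcongr

/-- two-domain energy estimate with well-posed interface conditions:
`d/dt E_b ≤ C_{a,b} E_b`, and for constant coefficients `C_{a,b} = 0` and the
energy is conserved. -/
theorem two_domain_energy_estimate
    (Bm Bp xI : ℝ) (hI : xI ∈ Set.Ioo Bm Bp)
    (a b : ℝ → ℝ) (ha : ContDiff ℝ 1 a) (hb : ContDiff ℝ 1 b)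
    (hbpos : ∀ x ∈ Set.Icc Bm Bp, 0 < b x)
    (um up : ℝ → ℝ → ℝ)
    (hum : ContDiff ℝ 2 (fun p : ℝ × ℝ => um p.1 p.2))
    (hup : ContDiff ℝ 2 (fun p : ℝ × ℝ => up p.1 p.2))
    (hpdem : ∀ x ∈ Set.Icc Bm xI, ∀ t : ℝ, 0 ≤ t →
      deriv (fun s => pdt um x s - a x * pdx um x s) t
        - deriv (fun y => a y * (pdt um y t - a y * pdx um y t) + b y * pdx um y t) x = 0)
    (hpdep : ∀ x ∈ Set.Icc xI Bp, ∀ t : ℝ, 0 ≤ t →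
      deriv (fun s => pdt up x s - a x * pdx up x s) t
        - deriv (fun y => a y * (pdt up y t - a y * pdx up y t) + b y * pdx up y t) x = 0)
    (hint1 : ∀ t : ℝ, 0 ≤ t →
      pdt um xI t - a xI * pdx um xI t = pdt up xI t - a xI * pdx up xI t)
    (hint2 : ∀ t : ℝ, 0 ≤ t →
      a xI * (pdt um xI t - a xI * pdx um xI t) + b xI * pdx um xI t
        = a xI * (pdt up xI t - a xI * pdx up xI t) + b xI * pdx up xI t)
    (hbdm : ∀ t : ℝ, 0 ≤ t →
      (pdt um Bm t - a Bm * pdx um Bm t)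
          * (a Bm * (pdt um Bm t - a Bm * pdx um Bm t) + b Bm * pdx um Bm t)
        + b Bm * pdx um Bm t * pdt um Bm t = 0)
    (hbdp : ∀ t : ℝ, 0 ≤ t →
      (pdt up Bp t - a Bp * pdx up Bp t)
          * (a Bp * (pdt up Bp t - a Bp * pdx up Bp t) + b Bp * pdx up Bp t)
        + b Bp * pdx up Bp t * pdt up Bp t = 0)
    (E : ℝ → ℝ)
    (hE : E = fun t =>
      ((∫ x in Bm..xI, (pdt um x t - a x * pdx um x t) ^ 2)
        + ∫ x in Bm..xI, b x * (pdx um x t) ^ 2)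
      + ((∫ x in xI..Bp, (pdt up x t - a x * pdx up x t) ^ 2)
        + ∫ x in xI..Bp, b x * (pdx up x t) ^ 2))
    (C : ℝ)
    (hC : C = sSup ((fun x => |deriv a x| + |deriv a x - a x / b x * deriv b x|) ''
        Set.Icc Bm Bp)) :
    (∀ t : ℝ, 0 ≤ t → deriv E t ≤ C * E t) ∧
    ((∀ x y : ℝ, a x = a y) → (∀ x y : ℝ, b x = b y) →
      C = 0 ∧ ∀ t : ℝ, 0 ≤ t → deriv E t = 0) := by
  obtain ⟨hl, hr⟩ := hI
  have hderiv : ∀ t : ℝ, 0 ≤ t → deriv E t =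
      (∫ x in Bm..xI, (deriv a x * (pdt um x t - a x * pdx um x t) ^ 2
        + (deriv a x * b x - a x * deriv b x) * (pdx um x t) ^ 2))
      + ∫ x in xI..Bp, (deriv a x * (pdt up x t - a x * pdx up x t) ^ 2
        + (deriv a x * b x - a x * deriv b x) * (pdx up x t) ^ 2) := by
    intro t ht
    have hd := (hasDerivAt_energy ha hb hum hl.le fun x hx => hpdem x hx t ht).add
      (hasDerivAt_energy ha hb hup hr.le fun x hx => hpdep x hx t ht)
    have hE' : deriv E t = _ := (congrArg (deriv · t) hE).trans hd.deriv
    have i1 := hint1 t ht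
    have i2 := hint2 t ht
    rw [i1] at i2
    have hw : pdx um xI t = pdx up xI t :=
      mul_left_cancel₀ (hbpos xI ⟨hl.le, hr.le⟩).ne' (add_left_cancel i2)
    have hp : pdt um xI t = pdt up xI t := by
      rw [hw] at i1
      linarith
    rw [hE', hbdm t ht, hbdp t ht, hw, hp]
    ring
  constructor
  · intro t ht
    have hbdd : BddAbove ((fun x => |deriv a x| + |deriv a x - a x / b x * deriv b x|) ''
        Set.Icc Bm Bp) := by
      have ha'c := (ha.continuous_deriv le_rfl).continuousOn (s := Set.Icc Bm Bp)
      have hb'c := (hb.continuous_deriv le_rfl).continuousOn (s := Set.Icc Bm Bp)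
      exact isCompact_Icc.bddAbove_image (ha'c.abs.add (ha'c.sub
        ((ha.continuous.continuousOn.div hb.continuous.continuousOn
          fun x hx => (hbpos x hx).ne').mul hb'c)).abs)
    have hCle : ∀ x ∈ Set.Icc Bm Bp,
        |deriv a x| + |deriv a x - a x / b x * deriv b x| ≤ C := fun x hx => by
      rw [hC]
      exact le_csSup hbdd ⟨x, hx, rfl⟩
    have hsm : Set.Icc Bm xI ⊆ Set.Icc Bm Bp := Set.Icc_subset_Icc_right hr.le
    have hsp : Set.Icc xI Bp ⊆ Set.Icc Bm Bp := Set.Icc_subset_Icc_left hl.le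
    have hm := integral_bulk_le ha hb hum hl.le (fun x hx => hbpos x (hsm hx))
      (fun x hx => hCle x (hsm hx)) t
    have hp := integral_bulk_le ha hb hup hr.le (fun x hx => hbpos x (hsp hx))
      (fun x hx => hCle x (hsp hx)) t
    rw [hderiv t ht, hE, mul_add]
    exact add_le_add hm hp
  · intro hac hbc
    have ha0 : ∀ x, deriv a x = 0 := fun x => by
      rw [show a = fun _ => a 0 from funext fun y => hac y 0, deriv_const]
    have hb0 : ∀ x, deriv b x = 0 := fun x => by
      rw [show b = fun _ => b 0 from funext fun y => hbc y 0, deriv_const]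
    refine ⟨?_, fun t ht => ?_⟩
    · have hne : (Set.Icc Bm Bp).Nonempty := Set.nonempty_Icc.2 (hl.trans hr).le
      simp [hC, ha0, hb0, hne.image_const]
    · simp [hderiv t ht, ha0, hb0]
end

section
/- Let m ≥ 1, let 𝐇 ∈ ℝ^{m×m} be diagonal with positive diagonal entries, and let D̃ ∈ ℝ^{m×m} satisfy 𝐇D̃ + D̃ᵀ𝐇 = 0 (the penalized SBP operator with periodic/no external boundary contributions) and D̃𝟙 = 0, where 𝟙 ∈ ℝᵐ is the all-ones vector. Let 𝐚 and 𝐛 be diagonal m×m matrices and set A_b := D̃ᵀ 𝐛 𝐇 D̃. If U, W : ℝ → ℝᵐ are differentiable and satisfy W′(t) = D̃(𝐚 W(t)) − 𝐇⁻¹ A_b U(t) for all t, then the discrete conserved quantity ⟨𝟙, W(t)⟩_𝐇 := 𝟙ᵀ 𝐇 W(t) is constant in time: d/dt (𝟙ᵀ 𝐇 W(t)) = 0. -/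
open Matrix

/-- The derivative of `s ↦ v ⬝ᵥ (A *ᵥ W s)`, a fixed linear functional of `W`. -/
theorem HasDerivAt.const_dotProduct_mulVec {m n : Type*} [Fintype m] [Fintype n]
    (v : m → ℝ) (A : Matrix m n ℝ) {W : ℝ → n → ℝ} {W' : n → ℝ} {t : ℝ}
    (hW : HasDerivAt W W' t) :
    HasDerivAt (fun s => v ⬝ᵥ (A *ᵥ W s)) (v ⬝ᵥ (A *ᵥ W')) t := by
  simp only [dotProduct_mulVec]
  exact HasDerivAt.fun_sum fun i _ => ((hasDerivAt_pi.mp hW) i).const_mul _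

/-- If `H * D + Dᵀ * H = 0` and `D` annihilates `v`, then `v` annihilates the
range of `H * D`. -/
theorem Matrix.vecMul_vecMul_eq_zero_of_sbp {n R : Type*} [Fintype n] [CommRing R]
    {H D : Matrix n n R} {v : n → R} (hanti : H * D + Dᵀ * H = 0) (hv : D *ᵥ v = 0) :
    (v ᵥ* H) ᵥ* D = 0 := by
  rw [vecMul_vecMul, eq_neg_of_add_eq_zero_left hanti, vecMul_neg, ← vecMul_vecMul,
    vecMul_transpose, hv, zero_vecMul, neg_zero]

/-- discrete conservation: under the semi-discrete evolution
`W′ = D̃(𝐚W) − 𝐇⁻¹A_bU` with `𝐇D̃ + D̃ᵀ𝐇 = 0` and `D̃𝟙 = 0`, the quantity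
`⟨𝟙, W⟩_𝐇 = 𝟙ᵀ𝐇W` is constant in time. -/
theorem discrete_conservation (m : ℕ)
    (d : Fin (m + 1) → ℝ) (hd : ∀ i, 0 < d i)
    (Dt : Matrix (Fin (m + 1)) (Fin (m + 1)) ℝ)
    (hanti : diagonal d * Dt + Dtᵀ * diagonal d = 0)
    (hones : Dt *ᵥ (fun _ => (1 : ℝ)) = 0)
    (da db : Fin (m + 1) → ℝ)
    (U W : ℝ → Fin (m + 1) → ℝ)
    (hU : Differentiable ℝ U)
    (hW : ∀ t : ℝ, HasDerivAt W
      (Dt *ᵥ (diagonal da *ᵥ W t)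
        - (diagonal d)⁻¹ *ᵥ ((Dtᵀ * diagonal db * diagonal d * Dt) *ᵥ U t)) t) :
    ∀ t : ℝ,
      deriv (fun s => (fun _ => (1 : ℝ)) ⬝ᵥ (diagonal d *ᵥ W s)) t = 0 := by
  intro t
  refine (HasDerivAt.const_dotProduct_mulVec _ (diagonal d) (hW t)).deriv.trans ?_
  have hdet : IsUnit (diagonal d).det := by
    rw [det_diagonal]
    exact (Finset.prod_pos fun i _ => hd i).ne'.isUnit
  rw [mulVec_sub, dotProduct_sub, dotProduct_mulVec, dotProduct_mulVec,
    vecMul_vecMul_eq_zero_of_sbp hanti hones, zero_dotProduct, mulVec_mulVec,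
    mul_nonsing_inv _ hdet, one_mulVec, Matrix.mul_assoc, Matrix.mul_assoc, ← mulVec_mulVec,
    dotProduct_mulVec, vecMul_transpose, hones, zero_dotProduct, sub_zero]
end

section
/- Let m ≥ 1, let 𝐇 ∈ ℝ^{m×m} be diagonal with positive diagonal entries, and let D̃ ∈ ℝ^{m×m} satisfy 𝐇D̃ + D̃ᵀ𝐇 = 0 (the penalized SBP operator with periodic/no external boundary contributions). Let a ∈ ℝ and b > 0 be constants and set A_b := b·D̃ᵀ𝐇D̃. If U, W : ℝ → ℝᵐ are differentiable and satisfy U′(t) = a·D̃U(t) + W(t) and W′(t) = a·D̃W(t) − 𝐇⁻¹A_b U(t) for all t, then the discrete energy ℰ_b(t) := W(t)ᵀ𝐇W(t) + b·(D̃U(t))ᵀ𝐇(D̃U(t)) is nonnegative and constant in time: d/dt ℰ_b(t) = 0. -/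
open Matrix

section WeightedForm

variable {n : Type*} [Fintype n]

theorem dotProduct_mulVec_mulVec_of_anti {H D : Matrix n n ℝ} (h : H * D + Dᵀ * H = 0)
    (x y : n → ℝ) : x ⬝ᵥ (H *ᵥ (D *ᵥ y)) = -((D *ᵥ x) ⬝ᵥ (H *ᵥ y)) := by
  rw [mulVec_mulVec, eq_neg_of_add_eq_zero_left h, neg_mulVec, dotProduct_neg,
    ← mulVec_mulVec, dotProduct_mulVec, vecMul_transpose]

theorem HasDerivAt.mulVec_const_left (D : Matrix n n ℝ) {f : ℝ → n → ℝ} {f' : n → ℝ}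
    {t : ℝ} (hf : HasDerivAt f f' t) : HasDerivAt (fun s => D *ᵥ f s) (D *ᵥ f') t :=
  (LinearMap.toContinuousLinearMap D.mulVecLin).hasFDerivAt.comp_hasDerivAt t hf

variable [DecidableEq n]

theorem dotProduct_diagonal_mulVec_comm (d x y : n → ℝ) :
    x ⬝ᵥ (diagonal d *ᵥ y) = y ⬝ᵥ (diagonal d *ᵥ x) := by
  simp only [dotProduct, mulVec_diagonal]
  exact Finset.sum_congr rfl fun i _ => by ring

theorem dotProduct_diagonal_mulVec_self_nonneg {d : n → ℝ} (hd : ∀ i, 0 ≤ d i) (x : n → ℝ) :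
    0 ≤ x ⬝ᵥ (diagonal d *ᵥ x) := by
  simp only [dotProduct, mulVec_diagonal]
  refine Finset.sum_nonneg fun i _ => ?_
  rw [mul_left_comm]
  exact mul_nonneg (hd i) (mul_self_nonneg _)

theorem HasDerivAt.dotProduct_diagonal_mulVec_self (d : n → ℝ) {f : ℝ → n → ℝ} {f' : n → ℝ}
    {t : ℝ} (hf : HasDerivAt f f' t) :
    HasDerivAt (fun s => f s ⬝ᵥ (diagonal d *ᵥ f s)) (2 * (f' ⬝ᵥ (diagonal d *ᵥ f t))) t := by
  simp only [dotProduct, mulVec_diagonal, Finset.mul_sum]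
  refine HasDerivAt.fun_sum fun i _ => ?_
  have hi := hasDerivAt_pi.1 hf i
  exact (hi.mul (hi.const_mul (d i))).congr_deriv (by ring)

theorem diagonal_inv_mulVec_stiffness {d : n → ℝ} (hd : ∀ i, d i ≠ 0) {D : Matrix n n ℝ}
    (h : diagonal d * D + Dᵀ * diagonal d = 0) (b : ℝ) (x : n → ℝ) :
    (diagonal d)⁻¹ *ᵥ ((b • (Dᵀ * diagonal d * D)) *ᵥ x) = -(b • (D *ᵥ (D *ᵥ x))) := by
  have hdet : IsUnit (diagonal d).det := by
    rw [det_diagonal, isUnit_iff_ne_zero]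
    exact Finset.prod_ne_zero_iff.2 fun i _ => hd i
  rw [eq_neg_of_add_eq_zero_right h, mulVec_mulVec, Matrix.mul_smul, Matrix.neg_mul,
    Matrix.mul_neg, Matrix.mul_assoc, nonsing_inv_mul_cancel_left _ _ hdet, smul_neg,
    neg_mulVec, smul_mulVec, mulVec_mulVec]

end WeightedForm

/-- discrete energy conservation for the constant-coefficient
semi-discrete shifted wave equation: `ℰ_b(t) = ⟨W,W⟩_𝐇 + b⟨D̃U, D̃U⟩_𝐇` is
nonnegative and constant in time. -/
theorem discrete_energy_conservation_b (m : ℕ)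
    (d : Fin (m + 1) → ℝ) (hd : ∀ i, 0 < d i)
    (Dt : Matrix (Fin (m + 1)) (Fin (m + 1)) ℝ)
    (hanti : diagonal d * Dt + Dtᵀ * diagonal d = 0)
    (a b : ℝ) (hb : 0 < b)
    (U W : ℝ → Fin (m + 1) → ℝ)
    (hU : ∀ t : ℝ, HasDerivAt U (a • (Dt *ᵥ U t) + W t) t)
    (hW : ∀ t : ℝ, HasDerivAt W
      (a • (Dt *ᵥ W t)
        - (diagonal d)⁻¹ *ᵥ ((b • (Dtᵀ * diagonal d * Dt)) *ᵥ U t)) t)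
    (E : ℝ → ℝ)
    (hE : E = fun t => W t ⬝ᵥ (diagonal d *ᵥ W t)
        + b * ((Dt *ᵥ U t) ⬝ᵥ (diagonal d *ᵥ (Dt *ᵥ U t)))) :
    (∀ t : ℝ, 0 ≤ E t) ∧ ∀ t : ℝ, deriv E t = 0 := by
  subst hE
  refine ⟨fun t => add_nonneg (dotProduct_diagonal_mulVec_self_nonneg (fun i => (hd i).le) _)
    (mul_nonneg hb.le (dotProduct_diagonal_mulVec_self_nonneg (fun i => (hd i).le) _)),
    fun t => ?_⟩
  have hE := ((hW t).dotProduct_diagonal_mulVec_self d).add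
    ((((hU t).mulVec_const_left Dt).dotProduct_diagonal_mulVec_self d).const_mul b)
  refine (hE.congr_deriv ?_).deriv
  have hself : ∀ x, (Dt *ᵥ x) ⬝ᵥ (diagonal d *ᵥ x) = 0 := fun x => by
    have h₁ := dotProduct_mulVec_mulVec_of_anti hanti x x
    have h₂ := dotProduct_diagonal_mulVec_comm d x (Dt *ᵥ x)
    linarith
  have hcross := dotProduct_mulVec_mulVec_of_anti hanti (Dt *ᵥ U t) (W t)
  rw [dotProduct_diagonal_mulVec_comm] at hcross
  rw [diagonal_inv_mulVec_stiffness (fun i => (hd i).ne') hanti]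
  simp only [sub_neg_eq_add, mulVec_add, mulVec_smul, add_dotProduct, smul_dotProduct,
    smul_eq_mul, hself, hcross]
  ring
end
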